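/- For all u₁, u₂, u₃, a, b, c ∈ ℂ, the sl(3) Lax matrix L(u₁,u₂,u₃) (the 3×3 matrix of operators on ℂ[x,y,z] with entries L₁₁ = x∂ₓ+y∂_y+u₁+2, L₁₂ = ∂ₓ, L₁₃ = ∂_y, L₂₁ = −x²∂ₓ−xy∂_y+(xz+y)∂_z+(u₂−u₁−1)x, L₂₂ = −x∂ₓ+z∂_z+u₂+1, L₂₃ = ∂_z−x∂_y, L₃₁ = −xy∂ₓ−y²∂_y−z(xz+y)∂_z+(u₃−u₂−1)xz+(u₃−u₁−2)y, L₃₂ = −y∂ₓ−z²∂_z+(u₃−u₂−1)z, L₃₃ = −y∂_y−z∂_z+u₃) satisfies the invariance identity M⁻¹ · L(u₁,u₂,u₃) · M = S⁻¹ L(u₁,u₂,u₃) S, where M is the numeric matrix [[1,0,0],[−a,1,0],[−b,−c,1]], S = σ_c ∘ σ_b ∘ σ_a is the composition of substitution operators σ_a Φ(x,y,z) = Φ(x+a,y,z), σ_b Φ(x,y,z) = Φ(x,y+b,z), σ_c Φ(x,y,z) = Φ(x,y−cx,z+c), and S⁻¹ L S means conjugating every matrix entry by S. -/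

import Mathlib

open MvPolynomial

/-- The endomorphism ring of `ℂ[x,y,z]` (variables `x = X 0`, `y = X 1`, `z = X 2`). -/
abbrev E3 : Type := Module.End ℂ (MvPolynomial (Fin 3) ℂ)

/-- Multiplication operators `x, y, z` on `ℂ[x,y,z]`. -/
noncomputable def Zm (i : Fin 3) : E3 := LinearMap.mulLeft ℂ (X i)

/-- Partial derivatives `∂ₓ, ∂_y, ∂_z` on `ℂ[x,y,z]`. -/
noncomputable def Dm (i : Fin 3) : E3 := (pderiv i).toLinearMap

/-- The `sl(3)` Lax matrix `L(u₁,u₂,u₃)`. -/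
noncomputable def L3 (u₁ u₂ u₃ : ℂ) : Matrix (Fin 3) (Fin 3) E3 :=
  !![Zm 0 * Dm 0 + Zm 1 * Dm 1 + (u₁ + 2) • 1, Dm 0, Dm 1;
     -(Zm 0 * Zm 0 * Dm 0) - Zm 0 * Zm 1 * Dm 1 + (Zm 0 * Zm 2 + Zm 1) * Dm 2
         + (u₂ - u₁ - 1) • Zm 0,
       -(Zm 0 * Dm 0) + Zm 2 * Dm 2 + (u₂ + 1) • 1,
       Dm 2 - Zm 0 * Dm 1;
     -(Zm 0 * Zm 1 * Dm 0) - Zm 1 * Zm 1 * Dm 1 - Zm 2 * (Zm 0 * Zm 2 + Zm 1) * Dm 2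
         + (u₃ - u₂ - 1) • (Zm 0 * Zm 2) + (u₃ - u₁ - 2) • Zm 1,
       -(Zm 1 * Dm 0) - Zm 2 * Zm 2 * Dm 2 + (u₃ - u₂ - 1) • Zm 2,
       -(Zm 1 * Dm 1) - Zm 2 * Dm 2 + u₃ • 1]

/-- The substitution `σ_a : Φ(x,y,z) ↦ Φ(x+a,y,z)`. -/
noncomputable def sigA (a : ℂ) : E3 :=
  (aeval ![X 0 + MvPolynomial.C a, X 1, X 2] :
      MvPolynomial (Fin 3) ℂ →ₐ[ℂ] MvPolynomial (Fin 3) ℂ).toLinearMap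

/-- The substitution `σ_b : Φ(x,y,z) ↦ Φ(x,y+b,z)`. -/
noncomputable def sigB (b : ℂ) : E3 :=
  (aeval ![X 0, X 1 + MvPolynomial.C b, X 2] :
      MvPolynomial (Fin 3) ℂ →ₐ[ℂ] MvPolynomial (Fin 3) ℂ).toLinearMap

/-- The substitution `σ_c : Φ(x,y,z) ↦ Φ(x, y−cx, z+c)`. -/
noncomputable def sigC (c : ℂ) : E3 :=
  (aeval ![X 0, X 1 - MvPolynomial.C c * X 0, X 2 + MvPolynomial.C c] :
      MvPolynomial (Fin 3) ℂ →ₐ[ℂ] MvPolynomial (Fin 3) ℂ).toLinearMap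

/-- `S = σ_c ∘ σ_b ∘ σ_a`. -/
noncomputable def Sfull (a b c : ℂ) : E3 := sigC c * sigB b * sigA a

/-- `S⁻¹ = σ_a⁻¹ ∘ σ_b⁻¹ ∘ σ_c⁻¹ = σ_{-a} ∘ σ_{-b} ∘ σ_{-c}`. -/
noncomputable def Sinv (a b c : ℂ) : E3 := sigA (-a) * sigB (-b) * sigC (-c)

/-- The numeric matrix `M = [[1,0,0],[−a,1,0],[−b,−c,1]]` (entries scalar operators). -/
noncomputable def Mmat (a b c : ℂ) : Matrix (Fin 3) (Fin 3) E3 :=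
  !![(1 : E3), 0, 0; (-a) • 1, 1, 0; (-b) • 1, (-c) • 1, 1]

/-- The inverse numeric matrix `M⁻¹ = [[1,0,0],[a,1,0],[b+ac,c,1]]`. -/
noncomputable def MmatInv (a b c : ℂ) : Matrix (Fin 3) (Fin 3) E3 :=
  !![(1 : E3), 0, 0; a • 1, 1, 0; (b + a * c) • 1, c • 1, 1]

lemma Sinv_mul_Sfull (a b c : ℂ) : Sinv a b c * Sfull a b c = 1 := by
  have h : ((((aeval ![X 0 + C (-a), X 1, X 2] : MvPolynomial (Fin 3) ℂ →ₐ[ℂ] _).comp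
      (aeval ![X 0, X 1 + C (-b), X 2])).comp
      (aeval ![X 0, X 1 - C (-c) * X 0, X 2 + C (-c)])).comp
      (((aeval ![X 0, X 1 - C c * X 0, X 2 + C c]).comp
      (aeval ![X 0, X 1 + C b, X 2])).comp (aeval ![X 0 + C a, X 1, X 2]))) =
      AlgHom.id ℂ (MvPolynomial (Fin 3) ℂ) := by
    apply algHom_ext
    intro i
    fin_cases i <;> simp [algHom_C]
  exact congrArg AlgHom.toLinearMap h

lemma Sfull_mul_Sinv (a b c : ℂ) : Sfull a b c * Sinv a b c = 1 := by
  have h : ((((aeval ![X 0, X 1 - C c * X 0, X 2 + C c] : MvPolynomial (Fin 3) ℂ →ₐ[ℂ] _).comp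
      (aeval ![X 0, X 1 + C b, X 2])).comp (aeval ![X 0 + C a, X 1, X 2])).comp
      (((aeval ![X 0 + C (-a), X 1, X 2]).comp
      (aeval ![X 0, X 1 + C (-b), X 2])).comp
      (aeval ![X 0, X 1 - C (-c) * X 0, X 2 + C (-c)]))) =
      AlgHom.id ℂ (MvPolynomial (Fin 3) ℂ) := by
    apply algHom_ext
    intro i
    fin_cases i <;> simp [algHom_C]
  exact congrArg AlgHom.toLinearMap h

lemma Sinv_Sfull_apply (a b c : ℂ) (p : MvPolynomial (Fin 3) ℂ) :
    Sinv a b c (Sfull a b c p) = p :=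
  LinearMap.congr_fun (Sinv_mul_Sfull a b c) p

lemma Sfull_apply_mul (a b c : ℂ) (p q : MvPolynomial (Fin 3) ℂ) :
    Sfull a b c (p * q) = Sfull a b c p * Sfull a b c q := by
  simp [Sfull, sigA, sigB, sigC]

lemma Sinv_apply_mul (a b c : ℂ) (p q : MvPolynomial (Fin 3) ℂ) :
    Sinv a b c (p * q) = Sinv a b c p * Sinv a b c q := by
  simp [Sinv, sigA, sigB, sigC]

lemma Sfull_C (a b c r : ℂ) : Sfull a b c (C r) = C r := by
  simp [Sfull, sigA, sigB, sigC, algHom_C]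

lemma Sinv_C (a b c r : ℂ) : Sinv a b c (C r) = C r := by
  simp [Sinv, sigA, sigB, sigC, algHom_C]

lemma Sfull_X_zero (a b c : ℂ) : Sfull a b c (X 0) = X 0 + C a := by
  simp [Sfull, sigA, sigB, sigC, algHom_C]

lemma Sfull_X_one (a b c : ℂ) : Sfull a b c (X 1) = X 1 - C c * X 0 + C b := by
  simp [Sfull, sigA, sigB, sigC, algHom_C]

lemma Sfull_X_two (a b c : ℂ) : Sfull a b c (X 2) = X 2 + C c := by
  simp [Sfull, sigA, sigB, sigC]

lemma Sinv_X_zero (a b c : ℂ) : Sinv a b c (X 0) = X 0 - C a := by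
  simp [Sinv, sigA, sigB, sigC, sub_eq_add_neg]

lemma Sinv_X_one (a b c : ℂ) :
    Sinv a b c (X 1) = X 1 - C b + C c * (X 0 - C a) := by
  simp [Sinv, sigA, sigB, sigC, algHom_C, sub_eq_add_neg]

lemma Sinv_X_two (a b c : ℂ) : Sinv a b c (X 2) = X 2 - C c := by
  simp [Sinv, sigA, sigB, sigC, algHom_C, sub_eq_add_neg]

/-- Chain rule for the substitution `S`. -/
lemma pderiv_Sfull (a b c : ℂ) (i : Fin 3) (p : MvPolynomial (Fin 3) ℂ) :
    pderiv i (Sfull a b c p) =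
      ∑ j, Sfull a b c (pderiv j p) * pderiv i (Sfull a b c (X j)) := by
  induction p using MvPolynomial.induction_on with
  | C r => simp [Sfull_C]
  | add p q hp hq => simp only [map_add, hp, hq, add_mul, Finset.sum_add_distrib]
  | mul_X p k hp =>
    simp only [Sfull_apply_mul, Derivation.leibniz, hp, smul_eq_mul, map_add, add_mul,
      Finset.sum_add_distrib, Finset.mul_sum, pderiv_X]
    refine congrArg₂ (· + ·) ?_ ?_
    · rw [Finset.sum_eq_single k]
      · simp [show Sfull a b c 1 = 1 by simpa using Sfull_C a b c 1]
      · intro j _ hj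
        simp [Pi.single_eq_of_ne hj.symm]
      · simp
    · exact Finset.sum_congr rfl fun j _ => by ring

lemma pderiv_zero_Sfull (a b c : ℂ) (p : MvPolynomial (Fin 3) ℂ) :
    pderiv 0 (Sfull a b c p) = Sfull a b c (pderiv 0 p) - C c * Sfull a b c (pderiv 1 p) := by
  rw [pderiv_Sfull, Fin.sum_univ_three, Sfull_X_zero, Sfull_X_one, Sfull_X_two]
  simp [pderiv_X]
  ring

lemma pderiv_one_Sfull (a b c : ℂ) (p : MvPolynomial (Fin 3) ℂ) :
    pderiv 1 (Sfull a b c p) = Sfull a b c (pderiv 1 p) := by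
  rw [pderiv_Sfull, Fin.sum_univ_three, Sfull_X_zero, Sfull_X_one, Sfull_X_two]
  simp [pderiv_X]

lemma pderiv_two_Sfull (a b c : ℂ) (p : MvPolynomial (Fin 3) ℂ) :
    pderiv 2 (Sfull a b c p) = Sfull a b c (pderiv 2 p) := by
  rw [pderiv_Sfull, Fin.sum_univ_three, Sfull_X_zero, Sfull_X_one, Sfull_X_two]
  simp [pderiv_X]

lemma MmatInv_mul_Mmat (a b c : ℂ) : MmatInv a b c * Mmat a b c = 1 := by
  simp only [MmatInv, Mmat, Matrix.one_fin_three]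
  refine Matrix.ext fun i j => ?_
  fin_cases i <;> fin_cases j <;>
    simp [Matrix.mul_apply, Fin.sum_univ_three, smul_smul] <;>
    module

lemma Mmat_mul_MmatInv (a b c : ℂ) : Mmat a b c * MmatInv a b c = 1 := by
  simp only [MmatInv, Mmat, Matrix.one_fin_three]
  refine Matrix.ext fun i j => ?_
  fin_cases i <;> fin_cases j <;>
    simp [Matrix.mul_apply, Fin.sum_univ_three, smul_smul] <;> module

/-- `sl(3)`-invariance of the Lax matrix: `M⁻¹ · L(u₁,u₂,u₃) · M = S⁻¹ L(u₁,u₂,u₃) S`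
(entrywise conjugation by `S = σ_c ∘ σ_b ∘ σ_a`), together with the facts that the
displayed matrices and operators are indeed two-sided inverses of each other. -/
theorem sl3_lax_invariance (u₁ u₂ u₃ a b c : ℂ) :
    MmatInv a b c * Mmat a b c = 1 ∧
    Mmat a b c * MmatInv a b c = 1 ∧
    Sinv a b c * Sfull a b c = 1 ∧
    Sfull a b c * Sinv a b c = 1 ∧
    MmatInv a b c * L3 u₁ u₂ u₃ * Mmat a b c
      = (L3 u₁ u₂ u₃).map (fun A => Sinv a b c * A * Sfull a b c) := by
  refine ⟨MmatInv_mul_Mmat a b c, Mmat_mul_MmatInv a b c, Sinv_mul_Sfull a b c,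
    Sfull_mul_Sinv a b c, ?_⟩
  refine Matrix.ext fun i j => LinearMap.ext fun p => ?_
  fin_cases i <;> fin_cases j <;>
    simp [L3, MmatInv, Mmat, Matrix.mul_apply, Fin.sum_univ_three, Zm, Dm,
      pderiv_zero_Sfull, pderiv_one_Sfull, pderiv_two_Sfull, Sinv_apply_mul, Sinv_X_zero,
      Sinv_X_one, Sinv_X_two, Sinv_Sfull_apply, Sinv_C] <;>
    simp only [smul_eq_C_mul, map_add, map_sub, map_mul, map_one, map_ofNat] <;>
    ring
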